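/- Independence of the leading-order terms from the digit number k: write ⟨A⟩^{(k)}(Δr) for the averaged quantity built with digit number k, and let q be the LOE exponent of (m, ε, δ): q = m−2 if m is even and ε = δ = 1; q = m if m is even and (ε,δ) ≠ (1,1); q = m−1 if m is odd and (ε = −1 or δ = 1); q = m+1 if m is odd, ε = 1 and δ = −1. Then for any two integers k, k' ≥ 1, lim_{Δr→0⁺} Δr^{−q}·( ⟨A⟩^{(k)}(Δr) − ⟨A⟩^{(k')}(Δr) ) = 0; i.e., the leading-order terms of the averaged T¹-type quantity are the same for every Markov-partition digit number k ≥ 1. -/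

import Mathlib

open Filter Finset

noncomputable section

/-- Transition probability η on trits: η(0) = (β/2)(1 − Pe/2), η(1) = 1 − β,
η(2) = (β/2)(1 + Pe/2). -/
def eta (β Pe : ℝ) (ω : Fin 3) : ℝ :=
  if (ω : ℕ) = 0 then β / 2 * (1 - Pe / 2)
  else if (ω : ℕ) = 1 then 1 - β
  else β / 2 * (1 + Pe / 2)

/-- ν(ω) = η(2 − ω). -/
def nu (β Pe : ℝ) (ω : Fin 3) : ℝ :=
  if (ω : ℕ) = 0 then β / 2 * (1 + Pe / 2)
  else if (ω : ℕ) = 1 then 1 - β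
  else β / 2 * (1 - Pe / 2)

/-- Bulk local density ρ̂ⱼ(u′) = (∏ η(u_d)/ν(u_d)) · ρ₀(r + (j + Σ (1 − u_d))·Δr). -/
def rhoHat (β Pe r Δr : ℝ) (ρ₀ : ℝ → ℝ) {K : ℕ} (j : ℤ) (u : Fin K → Fin 3) : ℝ :=
  (∏ d, eta β Pe (u d) / nu β Pe (u d)) *
    ρ₀ (r + ((j : ℝ) + ∑ d, (1 - ((u d : ℕ) : ℝ))) * Δr)

/-- F_j(ω, u) with u = u₀u′ :
F_j(ω,u) = f((η(ω)/ν(ω))·ρ̂_j(u′), (η(u₀)/ν(u₀))·ρ̂_{j+1−u₀}(u′)). -/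
def Floc (β Pe r Δr : ℝ) (ρ₀ : ℝ → ℝ) (f : ℝ → ℝ → ℝ) {K : ℕ}
    (j : ℤ) (ω u₀ : Fin 3) (u' : Fin K → Fin 3) : ℝ :=
  f (eta β Pe ω / nu β Pe ω * rhoHat β Pe r Δr ρ₀ j u')
    (eta β Pe u₀ / nu β Pe u₀ * rhoHat β Pe r Δr ρ₀ (j + 1 - ((u₀ : ℕ) : ℤ)) u')

/-- K(Δr): the sum over the trit ω and the k-digit trit string u = u₀u′. -/
def Ksum (D v β r : ℝ) (k : ℕ) (ρ₀ : ℝ → ℝ) (f : ℝ → ℝ → ℝ)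
    (ε δ : ℝ) (m : ℕ) (Δr : ℝ) : ℝ :=
  Δr * ∑ ω : Fin 3, ∑ u₀ : Fin 3, ∑ u' : Fin (k - 1) → Fin 3,
    (eta β (v * Δr / D) ω + δ * nu β (v * Δr / D) ω) *
      (nu β (v * Δr / D) u₀ * ∏ d, nu β (v * Δr / D) (u' d)) *
      (Floc β (v * Δr / D) r Δr ρ₀ f 0 ω u₀ u' +
        ε * (-1 : ℝ) ^ m * Floc β (v * Δr / D) r Δr ρ₀ f (1 - ((ω : ℕ) : ℤ)) ω u₀ u')

/-- The spatio-temporally averaged T¹-type quantity ⟨A⟩(Δr) = K/(τ·Δr),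
with τ = β·Δr²/(2D). -/
def avgA (D v β r : ℝ) (k : ℕ) (ρ₀ : ℝ → ℝ) (f : ℝ → ℝ → ℝ)
    (ε δ : ℝ) (m : ℕ) (Δr : ℝ) : ℝ :=
  Ksum D v β r k ρ₀ f ε δ m Δr / (β * Δr ^ 2 / (2 * D) * Δr)

/-- f̃(X,Y) = f(Y + X, Y − X). -/
def ftilde (f : ℝ → ℝ → ℝ) (X Y : ℝ) : ℝ := f (Y + X) (Y - X)

/-- Integrating a `C^n` family over a compact interval is `C^n` in the parameter. -/
theorem contDiff_nat_parametric_intervalIntegral {E : Type} [NormedAddCommGroup E]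
    [NormedSpace ℝ E] [ProperSpace E] (a b : ℝ) (n : ℕ) :
    ∀ {F : Type} [NormedAddCommGroup F] [NormedSpace ℝ F] {φ : E × ℝ → F},
      ContDiff ℝ n φ → ContDiff ℝ n (fun x => ∫ t in a..b, φ (x, t)) := by
  induction n with
  | zero =>
    intro F _ _ φ hφ
    have hc : Continuous φ := hφ.continuous
    exact contDiff_zero.2 (intervalIntegral.continuous_parametric_intervalIntegral_of_continuous'
      (f := fun x t => φ (x, t)) hc a b)
  | succ n ih =>
    intro F _ _ φ hφ
    have hφ1 : ContDiff ℝ 1 φ := hφ.of_le (by exact_mod_cast Nat.le_add_left 1 n)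
    have hdiff : Differentiable ℝ φ := hφ1.differentiable one_ne_zero
    let φ' : E × ℝ → (E →L[ℝ] F) := fun p =>
      (fderiv ℝ φ p).comp (ContinuousLinearMap.inl ℝ E ℝ)
    have hφ' : ContDiff ℝ n φ' :=
      (hφ.fderiv_right (m := n) (by norm_cast)).clm_comp contDiff_const
    have hderiv : ∀ x, HasFDerivAt (fun x => ∫ t in a..b, φ (x, t))
        (∫ t in a..b, φ' (x, t)) x := by
      intro x₀
      obtain ⟨C, hC⟩ := ((isCompact_closedBall x₀ 1).prod
        (isCompact_uIcc (a := a) (b := b))).exists_bound_of_continuousOn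
          hφ'.continuous.continuousOn
      refine intervalIntegral.hasFDerivAt_integral_of_dominated_of_fderiv_le
        (F := fun x t => φ (x, t)) (F' := fun x t => φ' (x, t)) (bound := fun _ => C)
        (Metric.closedBall_mem_nhds x₀ one_pos) ?_ ?_ ?_ ?_ ?_ ?_
      · exact Eventually.of_forall fun x =>
          (hφ.continuous.comp (by fun_prop)).aestronglyMeasurable
      · exact (hφ.continuous.comp (by fun_prop)).intervalIntegrable _ _
      · exact (hφ'.continuous.comp (by fun_prop)).aestronglyMeasurable
      · exact Eventually.of_forall fun t ht x hx =>
          hC (x, t) ⟨hx, Set.uIoc_subset_uIcc ht⟩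
      · exact intervalIntegrable_const
      · refine Eventually.of_forall fun t _ x _ => ?_
        exact (hdiff (x, t)).hasFDerivAt.comp x (hasFDerivAt_prodMk_left x t)
    push_cast
    refine contDiff_succ_iff_fderiv.2 ⟨fun x => (hderiv x).differentiableAt, by simp, ?_⟩
    rw [funext fun x => (hderiv x).fderiv]
    exact ih hφ'

/-- Hadamard's lemma with parameters: a smooth function vanishing on `{0} × E` is divisible
by the first coordinate. -/
theorem exists_contDiff_eq_fst_mul {E : Type} [NormedAddCommGroup E] [NormedSpace ℝ E]
    [ProperSpace E] {φ : ℝ × E → ℝ} (hφ : ContDiff ℝ (⊤ : ℕ∞) φ) (h0 : ∀ e, φ (0, e) = 0) :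
    ∃ ψ : ℝ × E → ℝ, ContDiff ℝ (⊤ : ℕ∞) ψ ∧ ∀ x e, φ (x, e) = x * ψ (x, e) := by
  let φ' : (ℝ × E) × ℝ → ℝ := fun p => fderiv ℝ φ (p.2 * p.1.1, p.1.2) (1, 0)
  have hφ' : ContDiff ℝ (⊤ : ℕ∞) φ' := by
    have h1 : ContDiff ℝ (⊤ : ℕ∞) (fderiv ℝ φ) := hφ.fderiv_right (by simp)
    exact (h1.comp (by fun_prop)).clm_apply contDiff_const
  refine ⟨fun p => ∫ t in (0 : ℝ)..1, φ' (p, t), ?_, fun x e => ?_⟩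
  · exact contDiff_infty.2 fun n =>
      contDiff_nat_parametric_intervalIntegral 0 1 n (contDiff_infty.1 hφ' n)
  · have hd : ∀ t : ℝ, HasDerivAt (fun t : ℝ => φ (t * x, e)) (x * φ' ((x, e), t)) t := by
      intro t
      have h1 : HasFDerivAt φ (fderiv ℝ φ (t * x, e)) (t * x, e) :=
        ((hφ.differentiable (by simp)) _).hasFDerivAt
      have h2 : HasDerivAt (fun t : ℝ => (t * x, e)) (x, (0 : E)) t :=
        (hasDerivAt_mul_const x).prodMk (hasDerivAt_const t e)
      have h3 := h1.comp_hasDerivAt t h2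
      have h4 : ((x, 0) : ℝ × E) = x • ((1, 0) : ℝ × E) := by simp
      rw [h4, map_smul] at h3
      exact h3
    have hc : Continuous fun t => x * φ' ((x, e), t) :=
      continuous_const.mul (hφ'.continuous.comp (by fun_prop))
    have := intervalIntegral.integral_eq_sub_of_hasDerivAt (fun t _ => hd t)
      (hc.intervalIntegrable 0 1)
    rw [intervalIntegral.integral_const_mul] at this
    simpa [h0] using this.symm

theorem exists_contDiff_eq_fst_pow_mul {E : Type} [NormedAddCommGroup E] [NormedSpace ℝ E]
    [ProperSpace E] {φ : ℝ × E → ℝ} (hφ : ContDiff ℝ (⊤ : ℕ∞) φ) (m : ℕ)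
    (h0 : ∀ e, ∀ j < m, iteratedDeriv j (fun x => φ (x, e)) 0 = 0) :
    ∃ ψ : ℝ × E → ℝ, ContDiff ℝ (⊤ : ℕ∞) ψ ∧ ∀ x e, φ (x, e) = x ^ m * ψ (x, e) := by
  induction m with
  | zero => exact ⟨φ, hφ, by simp⟩
  | succ m ih =>
    obtain ⟨ψ, hψ, hψe⟩ := ih fun e j hj => h0 e j (by lia)
    have hz : ∀ e, ψ (0, e) = 0 := by
      intro e
      have h1 := h0 e m (by lia)
      have h2 : ContDiff ℝ (⊤ : ℕ∞) fun x => ψ (x, e) := hψ.comp (by fun_prop)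
      simp only [hψe] at h1
      rw [iteratedDeriv_fun_mul (by fun_prop) (h2.contDiffAt.of_le (by exact_mod_cast le_top))] at h1
      rw [Finset.sum_eq_single m] at h1
      · simpa [iteratedDeriv_fun_pow_zero, Nat.factorial_ne_zero] using h1
      · intro i hi him
        rw [iteratedDeriv_fun_pow_zero, if_neg him]
        simp
      · simp
    obtain ⟨χ, hχ, hχe⟩ := exists_contDiff_eq_fst_mul hψ hz
    exact ⟨χ, hχ, fun x e => by rw [hψe, hχe]; ring⟩

/-- The logarithm of the ratio `η(2)/ν(2)`. -/
def logRatio (Pe : ℝ) : ℝ := Real.log ((1 + Pe / 2) / (1 - Pe / 2))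

theorem eta_div_nu_eq_exp {β Pe : ℝ} (hβ0 : 0 < β) (hβ1 : β < 1) (hPe : |Pe| < 2) (ω : Fin 3) :
    eta β Pe ω / nu β Pe ω = Real.exp (-(logRatio Pe * (1 - ((ω : ℕ) : ℝ)))) := by
  obtain ⟨h1, h2⟩ := abs_lt.1 hPe
  have hp : 0 < 1 + Pe / 2 := by linarith
  have hm : 0 < 1 - Pe / 2 := by linarith
  have hβ : 1 - β ≠ 0 := by linarith
  have hexp : Real.exp (logRatio Pe) = (1 + Pe / 2) / (1 - Pe / 2) :=
    Real.exp_log (div_pos hp hm)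
  fin_cases ω
  · simp only [eta, nu, Real.exp_neg]
    simp only [Nat.cast_zero, sub_zero, mul_one, hexp]
    simp only [if_true]
    field_simp
  · simp [eta, nu, hβ]
  · have : (1 : ℝ) - ((2 : ℕ) : ℝ) = -1 := by norm_num
    simp only [eta, nu, this, mul_neg, mul_one, neg_neg, hexp]
    norm_num
    field_simp

theorem tendsto_logRatio_div (c : ℝ) :
    Tendsto (fun h : ℝ => logRatio (c * h) / h) (nhdsWithin 0 (Set.Ioi 0)) (nhds c) := by
  have hd : HasDerivAt (fun h : ℝ => logRatio (c * h)) c 0 := by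
    have h1 : HasDerivAt (fun h : ℝ => c * h / 2) (c / 2) 0 := by
      simpa using ((hasDerivAt_id (0 : ℝ)).const_mul c).div_const 2
    have h2 := ((h1.const_add 1).div (h1.const_sub 1) (by simp)).log (by simp)
    simp only [mul_zero, zero_div, sub_zero, add_zero, mul_one, one_mul, one_pow, div_one,
      sub_neg_eq_add, add_halves, Pi.div_apply] at h2
    exact h2
  have := hd.tendsto_slope.mono_left
    (nhdsWithin_mono (0 : ℝ) (fun x (hx : 0 < x) => (ne_of_gt hx : x ≠ 0)))
  refine this.congr fun h => ?_
  simp [slope_def_field, logRatio]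

/-- `F_j(ω, u)` as a smooth function of `(Δr, z, σ)`, where `x = 1 - ω`, `y = 1 - u₀`,
`z = Δr · ∑ (1 - u_d)` and `σ` is the logarithmic ratio per unit length. -/
def smoothLoc (r : ℝ) (ρ₀ : ℝ → ℝ) (f : ℝ → ℝ → ℝ) (x y j : ℝ) (p : ℝ × ℝ × ℝ) : ℝ :=
  f (Real.exp (-(p.2.2 * (p.1 * x + p.2.1))) * ρ₀ (r + (p.2.1 + j * p.1)))
    (Real.exp (-(p.2.2 * (p.1 * y + p.2.1))) * ρ₀ (r + (p.2.1 + (j + y) * p.1)))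

theorem Floc_eq_smoothLoc {β Pe : ℝ} (hβ0 : 0 < β) (hβ1 : β < 1) (hPe : |Pe| < 2) (r : ℝ)
    {h : ℝ} (hh : h ≠ 0) (ρ₀ : ℝ → ℝ) (f : ℝ → ℝ → ℝ) {n : ℕ} (j : ℤ) (ω u₀ : Fin 3)
    (u : Fin n → Fin 3) :
    Floc β Pe r h ρ₀ f j ω u₀ u =
      smoothLoc r ρ₀ f (1 - ((ω : ℕ) : ℝ)) (1 - ((u₀ : ℕ) : ℝ)) j
        (h, (∑ d, (1 - ((u d : ℕ) : ℝ))) * h, logRatio Pe / h) := by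
  simp only [Floc, rhoHat, smoothLoc, eta_div_nu_eq_exp hβ0 hβ1 hPe, ← Real.exp_sum,
    ← mul_assoc, ← Real.exp_add, Finset.sum_neg_distrib, ← Finset.mul_sum]
  congr 1
  · congr 2
    · field_simp
      ring
    · ring
  · congr 2
    · field_simp
      ring
    · push_cast
      ring

/-- `smoothLoc` is divisible by `Δr ^ m`, and the quotient at `Δr = 0` does not depend on the
cell `j`. -/
theorem exists_smoothLoc_eq_pow_mul (r : ℝ) {ρ₀ : ℝ → ℝ} {f : ℝ → ℝ → ℝ} {m : ℕ}
    (hρ : ContDiff ℝ (⊤ : ℕ∞) ρ₀) (hf : ContDiff ℝ (⊤ : ℕ∞) (Function.uncurry f))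
    (hlow : ∀ Y : ℝ, ∀ j < m, iteratedDeriv j (fun X => ftilde f X Y) 0 = 0) (x y : ℝ) :
    ∃ G : ℝ → ℝ × ℝ × ℝ → ℝ, (∀ j, ContDiff ℝ (⊤ : ℕ∞) (G j)) ∧
      (∀ j p, smoothLoc r ρ₀ f x y j p = p.1 ^ m * G j p) ∧
      ∀ j j' e, G j (0, e) = G j' (0, e) := by
  have hft : ContDiff ℝ (⊤ : ℕ∞) fun p : ℝ × ℝ => ftilde f p.1 p.2 :=
    hf.comp (g := Function.uncurry f) (f := fun p : ℝ × ℝ => (p.2 + p.1, p.2 - p.1))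
      (by fun_prop)
  obtain ⟨g, hg, hge⟩ := exists_contDiff_eq_fst_pow_mul hft m hlow
  let A : ℝ × ℝ × ℝ → ℝ := fun p =>
    Real.exp (-(p.2.2 * (p.1 * x + p.2.1))) * ρ₀ (r + p.2.1)
  let B : ℝ × ℝ × ℝ → ℝ := fun p =>
    Real.exp (-(p.2.2 * (p.1 * y + p.2.1))) * ρ₀ (r + (p.2.1 + y * p.1))
  have hA : ContDiff ℝ (⊤ : ℕ∞) A := by fun_prop
  have hB : ContDiff ℝ (⊤ : ℕ∞) B := by fun_prop
  have hX : ContDiff ℝ (⊤ : ℕ∞) fun p => (A p - B p) / 2 := by fun_prop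
  obtain ⟨W, hW, hWe⟩ := exists_contDiff_eq_fst_mul hX (by intro e; simp [A, B])
  let s : ℝ → ℝ × ℝ × ℝ → ℝ × ℝ × ℝ := fun j p => (p.1, p.2.1 + j * p.1, p.2.2)
  let E : ℝ → ℝ × ℝ × ℝ → ℝ := fun j p => Real.exp (p.2.2 * (j * p.1))
  have hs : ∀ j, ContDiff ℝ (⊤ : ℕ∞) (s j) := fun j => by fun_prop
  have hE : ∀ j, ContDiff ℝ (⊤ : ℕ∞) (E j) := fun j => by fun_prop
  refine ⟨fun j p => (E j p * W (s j p)) ^ m *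
    g (p.1 * (E j p * W (s j p)), E j p * ((A (s j p) + B (s j p)) / 2)), ?_, ?_, ?_⟩
  · intro j
    have := hs j
    have := hE j
    fun_prop
  · intro j p
    have hw : p.1 * W (s j p) = (A (s j p) - B (s j p)) / 2 := (hWe p.1 (s j p).2).symm
    have hX' : p.1 * (E j p * W (s j p)) = E j p * ((A (s j p) - B (s j p)) / 2) := by
      rw [← hw]; ring
    rw [← mul_assoc, ← mul_pow, ← hge]
    simp only [ftilde, hX', smoothLoc]
    congr 1
    · have : Real.exp (-(p.2.2 * (p.1 * x + p.2.1))) =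
          E j p * Real.exp (-(p.2.2 * (p.1 * x + (p.2.1 + j * p.1)))) := by
        rw [← Real.exp_add]; congr 1; ring
      rw [this]
      simp only [A, B, s]
      ring
    · have : Real.exp (-(p.2.2 * (p.1 * y + p.2.1))) =
          E j p * Real.exp (-(p.2.2 * (p.1 * y + (p.2.1 + j * p.1)))) := by
        rw [← Real.exp_add]; congr 1; ring
      have h2 : r + (p.2.1 + (j + y) * p.1) = r + (p.2.1 + j * p.1 + y * p.1) := by ring
      rw [this, h2]
      simp only [A, B, s]
      ring
  · intro j j' e
    simp [E, s]

theorem exists_smoothLoc_add_eq_pow_mul (r : ℝ) {ρ₀ : ℝ → ℝ} {f : ℝ → ℝ → ℝ} {m : ℕ}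
    (hρ : ContDiff ℝ (⊤ : ℕ∞) ρ₀) (hf : ContDiff ℝ (⊤ : ℕ∞) (Function.uncurry f))
    (hlow : ∀ Y : ℝ, ∀ j < m, iteratedDeriv j (fun X => ftilde f X Y) 0 = 0) (x y j j' : ℝ)
    {c : ℝ} {q : ℕ} (hq : q = m ∨ q = m + 1 ∧ c = -1) :
    ∃ Ψ : ℝ × ℝ × ℝ → ℝ, ContDiff ℝ (⊤ : ℕ∞) Ψ ∧
      ∀ p, smoothLoc r ρ₀ f x y j p + c * smoothLoc r ρ₀ f x y j' p = p.1 ^ q * Ψ p := by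
  obtain ⟨G, hG, hGe, hG0⟩ := exists_smoothLoc_eq_pow_mul r hρ hf hlow x y
  have hsum : ContDiff ℝ (⊤ : ℕ∞) fun p => G j p + c * G j' p :=
    (hG j).add (contDiff_const.mul (hG j'))
  rcases hq with rfl | ⟨rfl, rfl⟩
  · exact ⟨_, hsum, fun p => by rw [hGe, hGe]; ring⟩
  · obtain ⟨Ψ, hΨ, hΨe⟩ := exists_contDiff_eq_fst_mul hsum
      (by intro e; rw [hG0 j j' e]; ring)
    refine ⟨Ψ, hΨ, fun p => ?_⟩
    rw [hGe, hGe, pow_succ, mul_assoc, ← hΨe p.1 p.2]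
    ring

theorem sum_nu (β Pe : ℝ) : ∑ ω, nu β Pe ω = 1 := by
  simp [Fin.sum_univ_three, nu]
  ring

theorem sum_prod_eq_one {α : Type*} [Fintype α] {w : α → ℝ} (hw : ∑ a, w a = 1) (n : ℕ) :
    ∑ u : Fin n → α, ∏ d, w (u d) = 1 := by
  induction n with
  | zero => simp
  | succ n ih =>
    rw [← (Fin.consEquiv fun _ => α).sum_comp, Fintype.sum_prod_type]
    simp [Fin.consEquiv, Fin.prod_univ_succ, ← Finset.mul_sum, ih, hw]

/-- The mean of a sum of `n` independent identically distributed digits. -/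
theorem sum_prod_mul_sum {α : Type*} [Fintype α] {w : α → ℝ} (hw : ∑ a, w a = 1)
    (c : α → ℝ) (n : ℕ) :
    ∑ u : Fin n → α, (∏ d, w (u d)) * ∑ d, c (u d) = n * ∑ a, w a * c a := by
  induction n with
  | zero => simp
  | succ n ih =>
    rw [← (Fin.consEquiv fun _ => α).sum_comp, Fintype.sum_prod_type]
    have key : ∀ a : α, ∑ u : Fin n → α, (w a * ∏ d, w (u d)) * (c a + ∑ d, c (u d)) =
        w a * c a + w a * (n * ∑ a, w a * c a) := by
      intro a
      rw [← ih, ← mul_one (w a * c a), ← sum_prod_eq_one hw n, Finset.mul_sum, Finset.mul_sum,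
        ← Finset.sum_add_distrib]
      exact Finset.sum_congr rfl fun u _ => by ring
    simp only [Fin.consEquiv, Equiv.coe_fn_mk, Fin.prod_univ_succ, Fin.sum_univ_succ,
      Fin.cons_zero, Fin.cons_succ, key]
    rw [Finset.sum_add_distrib, ← Finset.sum_mul, hw]
    push_cast
    ring

theorem continuous_nu (β : ℝ) (ω : Fin 3) : Continuous fun Pe => nu β Pe ω := by
  unfold nu
  split_ifs <;> fun_prop

theorem continuous_eta (β : ℝ) (ω : Fin 3) : Continuous fun Pe => eta β Pe ω := by
  unfold eta
  split_ifs <;> fun_prop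

/-- Averaging a smooth function over the displacement `z = Δr · ∑ (1 - u_d)` changes it only
by `o(Δr)`, since the mean displacement is `O(Δr²)`. -/
theorem average_sub_isLittleO {Ψ : ℝ × ℝ × ℝ → ℝ} (hΨ : ContDiff ℝ (⊤ : ℕ∞) Ψ) (β c σ₀ : ℝ)
    {σ : ℝ → ℝ} (hσ : Tendsto σ (nhdsWithin 0 (Set.Ioi 0)) (nhds σ₀)) (n : ℕ) :
    (fun h : ℝ => ∑ u : Fin n → Fin 3, (∏ d, nu β (c * h) (u d)) *
        Ψ (h, (∑ d, (1 - ((u d : ℕ) : ℝ))) * h, σ h) - Ψ (h, 0, σ h))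
      =o[nhdsWithin 0 (Set.Ioi 0)] fun h : ℝ => h := by
  have hid : Tendsto (fun h : ℝ => h) (nhdsWithin 0 (Set.Ioi 0)) (nhds 0) :=
    tendsto_nhdsWithin_of_tendsto_nhds tendsto_id
  have hstrict := hΨ.contDiffAt.hasStrictFDerivAt (x := ((0, 0, σ₀) : ℝ × ℝ × ℝ)) (by simp)
  set Ψ' := fderiv ℝ Ψ (0, 0, σ₀)
  have hterm : ∀ ξ : ℝ, (fun h : ℝ => Ψ (h, ξ * h, σ h) - Ψ (h, 0, σ h) -
      ξ * h * Ψ' (0, 1, 0)) =o[nhdsWithin 0 (Set.Ioi 0)] fun h : ℝ => h := by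
    intro ξ
    have ht : Tendsto (fun h : ℝ => (((h, ξ * h, σ h), (h, 0, σ h)) : (ℝ × ℝ × ℝ) × ℝ × ℝ × ℝ))
        (nhdsWithin 0 (Set.Ioi 0)) (nhds ((0, 0, σ₀), (0, 0, σ₀))) := by
      have h1 : Tendsto (fun h : ℝ => ξ * h) (nhdsWithin 0 (Set.Ioi 0)) (nhds 0) := by
        simpa using hid.const_mul ξ
      exact (hid.prodMk_nhds (h1.prodMk_nhds hσ)).prodMk_nhds
        (hid.prodMk_nhds (tendsto_const_nhds.prodMk_nhds hσ))
    have h2 := hstrict.isLittleO.comp_tendsto ht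
    have h3 : (fun h : ℝ => (ξ * h) • ((0, 1, 0) : ℝ × ℝ × ℝ))
        =O[nhdsWithin 0 (Set.Ioi 0)] fun h : ℝ => h := by
      refine Asymptotics.IsBigO.of_bound (|ξ| * ‖((0, 1, 0) : ℝ × ℝ × ℝ)‖)
        (Eventually.of_forall fun h => le_of_eq ?_)
      rw [norm_smul, Real.norm_eq_abs, abs_mul, Real.norm_eq_abs]
      ring
    refine (h2.trans_isBigO (h3.congr_left fun h => ?_)).congr_left fun h => ?_
    · simp
    · have : ((h, ξ * h, σ h) : ℝ × ℝ × ℝ) - (h, 0, σ h) = (ξ * h) • (0, 1, 0) := by simp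
      simp only [Function.comp, this, map_smul, smul_eq_mul]
  have hnu : ∀ ω, Tendsto (fun h : ℝ => nu β (c * h) ω) (nhdsWithin 0 (Set.Ioi 0))
      (nhds (nu β 0 ω)) := fun ω =>
    ((continuous_nu β ω).tendsto' 0 _ rfl).comp (by simpa using hid.const_mul c)
  have hsum : (fun h : ℝ => ∑ u : Fin n → Fin 3, (∏ d, nu β (c * h) (u d)) *
      (Ψ (h, (∑ d, (1 - ((u d : ℕ) : ℝ))) * h, σ h) - Ψ (h, 0, σ h) -
        (∑ d, (1 - ((u d : ℕ) : ℝ))) * h * Ψ' (0, 1, 0)))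
      =o[nhdsWithin 0 (Set.Ioi 0)] fun h : ℝ => h := by
    refine Asymptotics.IsLittleO.fun_sum fun u _ => ?_
    simpa using (tendsto_finsetProd Finset.univ
      (fun d _ => hnu (u d))).isBigO_one ℝ |>.mul_isLittleO (hterm _)
  have hmean : (fun h : ℝ => n * (β * (c * h) / 2) * (h * Ψ' (0, 1, 0)))
      =o[nhdsWithin 0 (Set.Ioi 0)] fun h : ℝ => h := by
    have h1 : (fun h : ℝ => n * (β * (c * h) / 2) * Ψ' (0, 1, 0))
        =o[nhdsWithin 0 (Set.Ioi 0)] fun _ : ℝ => (1 : ℝ) := by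
      rw [Asymptotics.isLittleO_one_iff]
      exact tendsto_nhdsWithin_of_tendsto_nhds (Continuous.tendsto' (by fun_prop) _ _ (by simp))
    simpa [mul_assoc, mul_comm, mul_left_comm] using
      h1.mul_isBigO (Asymptotics.isBigO_refl (fun h : ℝ => h) _)
  refine (hsum.add hmean).congr_left fun h => ?_
  have h1 := sum_prod_eq_one (sum_nu β (c * h)) n
  have h2 := sum_prod_mul_sum (sum_nu β (c * h)) (fun ω : Fin 3 => 1 - ((ω : ℕ) : ℝ)) n
  have h3 : ∑ ω : Fin 3, nu β (c * h) ω * (1 - ((ω : ℕ) : ℝ)) = β * (c * h) / 2 := by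
    simp [Fin.sum_univ_three, nu]
    ring
  rw [h3] at h2
  have h4 : ∀ (a X ξ : (Fin n → Fin 3) → ℝ) (P K : ℝ),
      ∑ u, a u * (X u - P - ξ u * h * K) =
        ∑ u, a u * X u - (∑ u, a u) * P - (∑ u, a u * ξ u) * (h * K) := by
    intro a X ξ P K
    simp only [mul_sub, Finset.sum_sub_distrib, Finset.sum_mul, mul_assoc]
  rw [h4, h1, h2]
  ring

theorem average_Floc_sub_isLittleO (D v β r : ℝ) {ρ₀ : ℝ → ℝ} {f : ℝ → ℝ → ℝ} {m : ℕ}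
    (hβ0 : 0 < β) (hβ1 : β < 1)
    (hρ : ContDiff ℝ (⊤ : ℕ∞) ρ₀) (hf : ContDiff ℝ (⊤ : ℕ∞) (Function.uncurry f))
    (hlow : ∀ Y : ℝ, ∀ j < m, iteratedDeriv j (fun X => ftilde f X Y) 0 = 0)
    {c : ℝ} {q : ℕ} (hq : q = m ∨ q = m + 1 ∧ c = -1) (j j' : ℤ) (ω u₀ : Fin 3) :
    ∃ B : ℝ → ℝ, ∀ n : ℕ,
      (fun h : ℝ => ∑ u : Fin n → Fin 3, (∏ d, nu β (v * h / D) (u d)) *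
          (Floc β (v * h / D) r h ρ₀ f j ω u₀ u + c * Floc β (v * h / D) r h ρ₀ f j' ω u₀ u) -
          B h)
        =o[nhdsWithin 0 (Set.Ioi 0)] fun h : ℝ => h ^ (q + 1) := by
  obtain ⟨Ψ, hΨ, hΨe⟩ := exists_smoothLoc_add_eq_pow_mul r hρ hf hlow
    (1 - ((ω : ℕ) : ℝ)) (1 - ((u₀ : ℕ) : ℝ)) j j' hq
  refine ⟨fun h => h ^ q * Ψ (h, 0, logRatio (v / D * h) / h), fun n => ?_⟩
  have havg := average_sub_isLittleO hΨ β (v / D) _ (tendsto_logRatio_div (v / D)) n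
  have hPe : ∀ᶠ h : ℝ in nhdsWithin 0 (Set.Ioi 0), |v / D * h| < 2 :=
    nhdsWithin_le_nhds ((Continuous.tendsto' (by fun_prop) (0 : ℝ) (0 : ℝ) (by simp) :
      Tendsto (fun h : ℝ => |v / D * h|) (nhds 0) (nhds 0)).eventually_lt_const two_pos)
  refine ((Asymptotics.isBigO_refl (fun h : ℝ => h ^ q) _).mul_isLittleO havg).congr' ?_
    (Eventually.of_forall fun h => (pow_succ h q).symm)
  filter_upwards [hPe, self_mem_nhdsWithin] with h hh hpos
  have hh0 : h ≠ 0 := ne_of_gt hpos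
  rw [show v * h / D = v / D * h by ring]
  simp only [Floc_eq_smoothLoc hβ0 hβ1 hh r hh0, hΨe, mul_sub, Finset.mul_sum]
  congr 1
  exact Finset.sum_congr rfl fun u _ => by ring

theorem eta_add_mul_nu_isBigO (D v β : ℝ) {δ : ℝ} {b : ℕ} (hb : b = 0 ∨ b = 1 ∧ δ = -1)
    (ω : Fin 3) :
    (fun h : ℝ => eta β (v * h / D) ω + δ * nu β (v * h / D) ω)
      =O[nhdsWithin 0 (Set.Ioi 0)] fun h : ℝ => h ^ b := by
  rcases hb with rfl | ⟨rfl, rfl⟩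
  · have hc : Continuous fun h : ℝ => eta β (v * h / D) ω + δ * nu β (v * h / D) ω :=
      ((continuous_eta β ω).comp (by fun_prop)).add
        (continuous_const.mul ((continuous_nu β ω).comp (by fun_prop)))
    simpa using (tendsto_nhdsWithin_of_tendsto_nhds (hc.tendsto 0)).isBigO_one ℝ
  · have : (fun h : ℝ => eta β (v * h / D) ω + -1 * nu β (v * h / D) ω) =
        fun h => (((ω : ℕ) : ℝ) - 1) * (β * v / (2 * D)) * h ^ 1 := by
      funext h
      fin_cases ω
      · simp [eta, nu]; ring
      · simp [eta, nu]
      · simp [eta, nu]; ring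
    rw [this]
    exact Asymptotics.isBigO_const_mul_self _ _ _

theorem Ksum_sub_isLittleO (D v β r : ℝ) {ρ₀ : ℝ → ℝ} {f : ℝ → ℝ → ℝ} {m : ℕ}
    (hβ0 : 0 < β) (hβ1 : β < 1)
    (hρ : ContDiff ℝ (⊤ : ℕ∞) ρ₀) (hf : ContDiff ℝ (⊤ : ℕ∞) (Function.uncurry f))
    (hlow : ∀ Y : ℝ, ∀ j < m, iteratedDeriv j (fun X => ftilde f X Y) 0 = 0)
    {ε δ : ℝ} {q b : ℕ} (hq : q = m ∨ q = m + 1 ∧ ε * (-1) ^ m = -1)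
    (hb : b = 0 ∨ b = 1 ∧ δ = -1) (k k' : ℕ) :
    (fun h : ℝ => Ksum D v β r k ρ₀ f ε δ m h - Ksum D v β r k' ρ₀ f ε δ m h)
      =o[nhdsWithin 0 (Set.Ioi 0)] fun h : ℝ => h * h ^ (b + (q + 1)) := by
  choose B hB using fun ω u₀ : Fin 3 => average_Floc_sub_isLittleO D v β r hβ0 hβ1 hρ hf hlow
    hq 0 (1 - ((ω : ℕ) : ℤ)) ω u₀
  have hdiff : ∀ ω u₀ : Fin 3, (fun h : ℝ =>
      (eta β (v * h / D) ω + δ * nu β (v * h / D) ω) * (nu β (v * h / D) u₀ *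
        ((∑ u : Fin (k - 1) → Fin 3, (∏ d, nu β (v * h / D) (u d)) *
          (Floc β (v * h / D) r h ρ₀ f 0 ω u₀ u +
            ε * (-1) ^ m * Floc β (v * h / D) r h ρ₀ f (1 - ((ω : ℕ) : ℤ)) ω u₀ u)) -
        ∑ u : Fin (k' - 1) → Fin 3, (∏ d, nu β (v * h / D) (u d)) *
          (Floc β (v * h / D) r h ρ₀ f 0 ω u₀ u +
            ε * (-1) ^ m * Floc β (v * h / D) r h ρ₀ f (1 - ((ω : ℕ) : ℤ)) ω u₀ u))))
      =o[nhdsWithin 0 (Set.Ioi 0)] fun h : ℝ => h ^ (b + (q + 1)) := by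
    intro ω u₀
    have hc : Continuous fun h : ℝ => nu β (v * h / D) u₀ :=
      (continuous_nu β u₀).comp (by fun_prop)
    have hnu := (tendsto_nhdsWithin_of_tendsto_nhds (s := Set.Ioi 0) (hc.tendsto 0)).isBigO_one ℝ
    have h1 := hnu.mul_isLittleO ((hB ω u₀ (k - 1)).sub (hB ω u₀ (k' - 1)))
    refine ((eta_add_mul_nu_isBigO D v β hb ω).mul_isLittleO h1).congr (fun h => ?_) fun h => ?_
    · ring
    · ring
  refine ((Asymptotics.isBigO_refl (fun h : ℝ => h) _).mul_isLittleO
    (Asymptotics.IsLittleO.fun_sum fun ω (_ : ω ∈ Finset.univ) =>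
      Asymptotics.IsLittleO.fun_sum fun u₀ (_ : u₀ ∈ Finset.univ) =>
        hdiff ω u₀)).congr_left fun h => ?_
  rw [Ksum, Ksum, ← mul_sub, ← Finset.sum_sub_distrib]
  congr 1
  refine Finset.sum_congr rfl fun ω _ => ?_
  rw [← Finset.sum_sub_distrib]
  refine Finset.sum_congr rfl fun u₀ _ => ?_
  simp only [mul_sub, Finset.mul_sum]
  congr 1 <;> exact Finset.sum_congr rfl fun u _ => by ring

theorem tendsto_zpow_mul_avgA_sub (D v β r : ℝ) {ρ₀ : ℝ → ℝ} {f : ℝ → ℝ → ℝ} {m : ℕ}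
    (hβ0 : 0 < β) (hβ1 : β < 1)
    (hρ : ContDiff ℝ (⊤ : ℕ∞) ρ₀) (hf : ContDiff ℝ (⊤ : ℕ∞) (Function.uncurry f))
    (hlow : ∀ Y : ℝ, ∀ j < m, iteratedDeriv j (fun X => ftilde f X Y) 0 = 0)
    {ε δ : ℝ} {q b : ℕ} (hq : q = m ∨ q = m + 1 ∧ ε * (-1) ^ m = -1)
    (hb : b = 0 ∨ b = 1 ∧ δ = -1) (k k' : ℕ) {Q : ℤ} (hQ : Q + 1 ≤ b + q) :
    Tendsto (fun h : ℝ => h ^ (-Q) *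
        (avgA D v β r k ρ₀ f ε δ m h - avgA D v β r k' ρ₀ f ε δ m h))
      (nhdsWithin 0 (Set.Ioi 0)) (nhds 0) := by
  obtain ⟨e, he⟩ := Int.eq_ofNat_of_zero_le (sub_nonneg.2 hQ)
  have h1 := (Ksum_sub_isLittleO D v β r hβ0 hβ1 hρ hf hlow hq hb k k').tendsto_div_nhds_zero
  have h2 : Tendsto (fun h : ℝ => 2 * D / β * h ^ e) (nhdsWithin 0 (Set.Ioi 0))
      (nhds (2 * D / β * 0 ^ e)) :=
    tendsto_nhdsWithin_of_tendsto_nhds (Continuous.tendsto (by fun_prop) 0)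
  have h3 := h2.mul h1
  rw [mul_zero] at h3
  refine h3.congr' ?_
  filter_upwards [self_mem_nhdsWithin] with h hpos
  have hh : h ≠ 0 := ne_of_gt hpos
  have hexp : h ^ e * (h ^ (b + (q + 1)))⁻¹ = h ^ (-Q) * (h ^ 2)⁻¹ := by
    rw [← zpow_natCast, ← zpow_natCast, ← zpow_natCast, ← zpow_neg, ← zpow_neg, ← zpow_add₀ hh,
      ← zpow_add₀ hh]
    congr 1
    push_cast
    lia
  simp only [avgA, ← sub_div]
  generalize Ksum D v β r k ρ₀ f ε δ m h - Ksum D v β r k' ρ₀ f ε δ m h = S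
  calc 2 * D / β * h ^ e * (S / (h * h ^ (b + (q + 1))))
      = 2 * D / β * (S / h) * (h ^ e * (h ^ (b + (q + 1)))⁻¹) := by
        rw [div_mul_eq_div_div, div_eq_mul_inv (S / h)]; ring
    _ = h ^ (-Q) * (S / (β * h ^ 2 / (2 * D) * h)) := by
        rw [hexp, div_mul_eq_div_div_swap, div_div_eq_mul_div, div_eq_mul_inv _ (β * h ^ 2),
          mul_inv]
        ring

open scoped Classical

/-- Independence of the leading-order terms from the digit number k: with q the LOE
exponent of (m,ε,δ) (q = m−2 if m even and ε = δ = 1; q = m if m even otherwise;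
q = m−1 if m odd and (ε = −1 or δ = 1); q = m+1 if m odd otherwise), for any two
digit numbers k, k′ ≥ 1 one has
lim_{Δr→0⁺} Δr^(−q)·(⟨A⟩^(k)(Δr) − ⟨A⟩^(k′)(Δr)) = 0. -/
theorem digit_number_independence
    (D v β r : ℝ) (ρ₀ : ℝ → ℝ) (f : ℝ → ℝ → ℝ)
    (ε δ : ℝ) (m : ℕ) (Chat : ℝ → ℝ)
    (hD : 0 < D) (hβ0 : 0 < β) (hβ1 : β < 1)
    (hρ : ContDiff ℝ (⊤ : ℕ∞) ρ₀) (hρpos : ∀ x, 0 < ρ₀ x)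
    (hf : ContDiff ℝ (⊤ : ℕ∞) (Function.uncurry f))
    (hε : ε = 1 ∨ ε = -1) (hδ : δ = 1 ∨ δ = -1)
    (hsym : ∀ x y, f y x = (-1 : ℝ) ^ m * f x y)
    (hlow : ∀ Y : ℝ, ∀ j < m, iteratedDeriv j (fun X => ftilde f X Y) 0 = 0)
    (hchar : ∀ Y : ℝ, iteratedDeriv m (fun X => ftilde f X Y) 0 = (m.factorial : ℝ) * Chat Y)
    (hCbdd : ∃ M : ℝ, ∀ y, |Chat y| ≤ M) (hCne : ∀ y, Chat y ≠ 0)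
    (k k' : ℕ) (hk : 1 ≤ k) (hk' : 1 ≤ k') :
    Filter.Tendsto
      (fun Δr : ℝ =>
        Δr ^ (-(if Even m then (if ε = 1 ∧ δ = 1 then (m : ℤ) - 2 else (m : ℤ))
            else (if ε = -1 ∨ δ = 1 then (m : ℤ) - 1 else (m : ℤ) + 1))) *
          (avgA D v β r k ρ₀ f ε δ m Δr - avgA D v β r k' ρ₀ f ε δ m Δr))
      (nhdsWithin 0 (Set.Ioi 0)) (nhds 0) := by
  apply tendsto_zpow_mul_avgA_sub D v β r hβ0 hβ1 hρ hf hlow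
    (q := if ε * (-1) ^ m = -1 then m + 1 else m) (b := if δ = -1 then 1 else 0)
  · split_ifs with h
    · exact Or.inr ⟨rfl, h⟩
    · exact Or.inl rfl
  · split_ifs with h
    · exact Or.inr ⟨rfl, h⟩
    · exact Or.inl rfl
  · rcases Nat.even_or_odd m with hm | hm
    · rcases hε with rfl | rfl <;> rcases hδ with rfl | rfl <;>
        norm_num [hm, hm.neg_one_pow]
    · rcases hε with rfl | rfl <;> rcases hδ with rfl | rfl <;>
        norm_num [Nat.not_even_iff_odd.2 hm, hm.neg_one_pow]
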